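/- arXiv:1906.06354 — 2 statements merged into one kernel-verified Lean document; each statement's English description precedes it below -/
import Mathlib

section
/- Let n ≥ 0, 0 ≤ k ≤ n, and s ≥ 1. Then P_s^-Λ^k(ℝ^{n+1}) = *_{S^n}P_{s-1}Λ^{n-k}(ℝ^{n+1}); that is, the image of P_{s-1}Λ^{k+1}(ℝ^{n+1}) under the interior product i_U with the radial vector field equals the image of P_{s-1}Λ^{n-k}(ℝ^{n+1}) under the map γ̂ ↦ *_{ℝ^{n+1}}(ν ∧ γ̂). -/
open scoped BigOperators
open MeasureTheory

noncomputable section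

/-- Vectors in `ℝ^m`. -/
abbrev Vec (m : ℕ) := Fin m → ℝ

/-- Differential `k`-forms on `ℝ^m`, given pointwise as alternating `k`-tensors. -/
abbrev Form (m k : ℕ) := Vec m → (Vec m [⋀^Fin k]→ₗ[ℝ] ℝ)

/-- A multivariate polynomial has (total) degree at most `r : ℤ`. -/
def degLE {m : ℕ} (r : ℤ) (p : MvPolynomial (Fin m) ℝ) : Prop :=
  ∀ d ∈ p.support, ((d.sum fun _ e => e : ℕ) : ℤ) ≤ r

/-- `P_rΛ^k(ℝ^m)`: differential `k`-forms with polynomial coefficients of degree at most `r`. -/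
def PL (m k : ℕ) (r : ℤ) : Set (Form m k) :=
  {α | ∀ v : Fin k → Vec m, ∃ p : MvPolynomial (Fin m) ℝ,
      degLE r p ∧ ∀ x, α x v = MvPolynomial.eval x p}

/-- Interior product with the radial vector field `X = Σ xᵢ ∂/∂xᵢ`. -/
def iU {m k : ℕ} (β : Form m (k + 1)) : Form m k := fun x => (β x).curryLeft x

/-- `P_r⁻Λ^k(ℝ^m) := i_X P_{r-1}Λ^{k+1}(ℝ^m)`. -/
def PLm (m k : ℕ) (r : ℤ) : Set (Form m k) := iU '' PL m (k + 1) (r - 1)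

/-- The reflection negating the `i`-th coordinate, as a map. -/
def reflFun (m : ℕ) (i : Fin m) (u : Vec m) : Vec m := fun j => if j = i then -u j else u j

/-- The reflection negating the `i`-th coordinate, as a linear map. -/
def reflLin (m : ℕ) (i : Fin m) : Vec m →ₗ[ℝ] Vec m :=
  LinearMap.pi fun j => if j = i then -LinearMap.proj j else LinearMap.proj j

/-- Pullback of an ambient form along the reflection `R_i`. -/
def reflPull (m k : ℕ) (i : Fin m) (α : Form m k) : Form m k :=
  fun x => (α (reflFun m i x)).compLinearMap (reflLin m i)

/-- A form on `ℝ^m` is even if it is invariant under all coordinate reflections. -/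
def IsEven (m k : ℕ) (α : Form m k) : Prop := ∀ i, reflPull m k i α = α

/-- A form on `ℝ^m` is odd if every coordinate reflection negates it. -/
def IsOdd (m k : ℕ) (α : Form m k) : Prop := ∀ i, reflPull m k i α = -α

/-- The map `Φ(u) = (u₁², …, u_m²)`. -/
def Phi (m : ℕ) (u : Vec m) : Vec m := fun i => u i ^ 2

/-- The differential of `Φ` at `u`. -/
def dPhi (m : ℕ) (u : Vec m) : Vec m →ₗ[ℝ] Vec m :=
  LinearMap.pi fun i => (2 * u i) • LinearMap.proj i

/-- Pullback of ambient forms along `Φ`. -/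
def phiPull (m k : ℕ) (α : Form m k) : Form m k :=
  fun u => (α (Phi m u)).compLinearMap (dPhi m u)

/-- The standard simplex `T^{m-1} ⊂ ℝ^m`. -/
def simplexSet (m : ℕ) : Set (Vec m) := {x | (∀ i, 0 ≤ x i) ∧ ∑ i, x i = 1}

/-- The unit sphere `S^{m-1} ⊂ ℝ^m`. -/
def sphereSet (m : ℕ) : Set (Vec m) := {u | ∑ i, u i ^ 2 = 1}

/-- The linear functional `v ↦ ⟨u, v⟩`. -/
def dotLin (m : ℕ) (u : Vec m) : Vec m →ₗ[ℝ] ℝ := ∑ i, u i • LinearMap.proj i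

/-- Orthogonal projection onto the tangent space of the sphere at `u`. -/
def projSph (m : ℕ) (u : Vec m) : Vec m →ₗ[ℝ] Vec m :=
  LinearMap.id - (dotLin m u).smulRight u

/-- The linear functional `v ↦ Σ vᵢ`. -/
def sumLin (m : ℕ) : Vec m →ₗ[ℝ] ℝ := ∑ i, LinearMap.proj i

/-- Orthogonal projection onto the tangent hyperplane `{Σ vᵢ = 0}` of the simplex. -/
def projSim (m : ℕ) : Vec m →ₗ[ℝ] Vec m :=
  LinearMap.id - ((m : ℝ)⁻¹ • sumLin m).smulRight (fun _ => 1)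

/-- Differential `k`-forms on a subset `M ⊆ ℝ^m`, encoded at each point by the canonical
alternating tensor on `ℝ^m` that vanishes in the directions normal to `M` (i.e. the
pullback along the inclusion, extended by the tangent projection). -/
abbrev FormOn (m : ℕ) (M : Set (Vec m)) (k : ℕ) := M → (Vec m [⋀^Fin k]→ₗ[ℝ] ℝ)

/-- Restriction (pullback along the inclusion) of an ambient form to the simplex. -/
def resSim (m k : ℕ) (α : Form m k) : FormOn m (simplexSet m) k :=
  fun x => (α x.1).compLinearMap (projSim m)

/-- Restriction (pullback along the inclusion) of an ambient form to the sphere. -/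
def resSph (m k : ℕ) (α : Form m k) : FormOn m (sphereSet m) k :=
  fun u => (α u.1).compLinearMap (projSph m u.1)

/-- `P_rΛ^k(T^{m-1})`. -/
def PLsim (m k : ℕ) (r : ℤ) : Set (FormOn m (simplexSet m) k) := resSim m k '' PL m k r

/-- `P_rΛ^k(S^{m-1})`. -/
def PLsph (m k : ℕ) (r : ℤ) : Set (FormOn m (sphereSet m) k) := resSph m k '' PL m k r

/-- `P_r⁻Λ^k(T^{m-1})`. -/
def PLmsim (m k : ℕ) (r : ℤ) : Set (FormOn m (simplexSet m) k) := resSim m k '' PLm m k r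

/-- `P_r⁻Λ^k(S^{m-1})`. -/
def PLmsph (m k : ℕ) (r : ℤ) : Set (FormOn m (sphereSet m) k) := resSph m k '' PLm m k r

lemma phi_mem_simplex {m : ℕ} {u : Vec m} (hu : u ∈ sphereSet m) :
    Phi m u ∈ simplexSet m :=
  ⟨fun _ => sq_nonneg _, hu⟩

/-- Pullback `Φ^* : Λ^k(T^{m-1}) → Λ^k(S^{m-1})` along `Φ : S^{m-1} → T^{m-1}`. -/
def phiPullTS (m k : ℕ) (a : FormOn m (simplexSet m) k) : FormOn m (sphereSet m) k :=
  fun u => (a ⟨Phi m u.1, phi_mem_simplex u.2⟩).compLinearMap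
    ((dPhi m u.1).comp (projSph m u.1))

lemma refl_mem_sphere {m : ℕ} {i : Fin m} {u : Vec m} (hu : u ∈ sphereSet m) :
    reflFun m i u ∈ sphereSet m := by
  have : ∀ j, (reflFun m i u j) ^ 2 = u j ^ 2 := by
    intro j; simp only [reflFun]; split <;> ring
  simpa only [sphereSet, Set.mem_setOf_eq, this] using hu

/-- Pullback of a form on the sphere along the reflection `R_i`. -/
def reflPullSph (m k : ℕ) (i : Fin m) (α : FormOn m (sphereSet m) k) :
    FormOn m (sphereSet m) k :=
  fun u => (α ⟨reflFun m i u.1, refl_mem_sphere u.2⟩).compLinearMap (reflLin m i)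

/-- A form on the sphere is even if it is invariant under all coordinate reflections. -/
def IsEvenSph (m k : ℕ) (α : FormOn m (sphereSet m) k) : Prop :=
  ∀ i, reflPullSph m k i α = α

/-- A form on the sphere is odd if every coordinate reflection negates it. -/
def IsOddSph (m k : ℕ) (α : FormOn m (sphereSet m) k) : Prop :=
  ∀ i, reflPullSph m k i α = -α

/-- The bubble function `u_N = u₁ ⋯ u_m`. -/
def bubble (m : ℕ) (u : Vec m) : ℝ := ∏ i, u i

/-- Multiplication of a form on the sphere by the bubble function. -/
def bubbleSmul (m k : ℕ) (α : FormOn m (sphereSet m) k) : FormOn m (sphereSet m) k :=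
  fun u => bubble m u.1 • α u

/-- Multiplication of an ambient form by the bubble function. -/
def bubbleSmulAmb (m k : ℕ) (α : Form m k) : Form m k :=
  fun u => bubble m u • α u

/-- The standard volume form on `ℝ^m`. -/
def volForm (m : ℕ) : (Vec m) [⋀^Fin m]→ₗ[ℝ] ℝ := (Pi.basisFun ℝ (Fin m)).det

/-- Iterated interior product: insert the vectors `v 0, …, v (k-1)` into the
first `k` slots of an alternating `(k+j)`-tensor. -/
def contrMany {m : ℕ} : (k : ℕ) → (Fin k → Vec m) → {j : ℕ} →
    ((Vec m) [⋀^Fin (k + j)]→ₗ[ℝ] ℝ) → ((Vec m) [⋀^Fin j]→ₗ[ℝ] ℝ)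
  | 0, _, j, α => α.domDomCongr (finCongr (Nat.zero_add j))
  | (k + 1), v, j, α =>
      contrMany k (fun i => v i.succ)
        ((α.domDomCongr (finCongr (by omega : (k + 1) + j = (k + j) + 1))).curryLeft (v 0))

/-- The Hodge star on alternating tensors on `ℝ^m` (standard metric and orientation):
`(⋆α)(w₁,…,w_{m-k}) = (1/k!) Σ_g α(e_{g 0},…,e_{g(k-1)}) vol(e_{g 0},…,e_{g(k-1)},w₁,…,w_{m-k})`. -/
def starAlt (m k : ℕ) (α : (Vec m) [⋀^Fin k]→ₗ[ℝ] ℝ) : (Vec m) [⋀^Fin (m - k)]→ₗ[ℝ] ℝ :=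
  if h : k ≤ m then
    (k.factorial : ℝ)⁻¹ •
      ∑ g : Fin k → Fin m,
        α (fun i => Pi.single (g i) 1) •
          contrMany k (fun i => Pi.single (g i) 1)
            ((volForm m).domDomCongr (finCongr (by omega : m = k + (m - k))))
  else 0

/-- The Hodge star `⋆_{ℝ^m}` applied pointwise to ambient forms. -/
def starR (m k : ℕ) (α : Form m k) : Form m (m - k) := fun x => starAlt m k (α x)

/-- The wedge product of alternating tensors. -/
def wedgeAlt {m k l : ℕ} (α : (Vec m) [⋀^Fin k]→ₗ[ℝ] ℝ) (β : (Vec m) [⋀^Fin l]→ₗ[ℝ] ℝ) :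
    (Vec m) [⋀^Fin (k + l)]→ₗ[ℝ] ℝ :=
  ((TensorProduct.lid ℝ ℝ).toLinearMap.compAlternatingMap (α.domCoprod β)).domDomCongr
    finSumFinEquiv

/-- The conormal `ν = Σ uᵢ duᵢ` at `u`, as an alternating 1-tensor. -/
def nuForm (m : ℕ) (u : Vec m) : (Vec m) [⋀^Fin 1]→ₗ[ℝ] ℝ :=
  AlternatingMap.ofSubsingleton ℝ (Vec m) ℝ (0 : Fin 1) (dotLin m u)

/-- The extended Hodge star `⋆_{S^{m-1}} α := ⋆_{ℝ^m}(ν ∧ α)` on ambient forms. -/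
def starSphAmb (m k : ℕ) (α : Form m k) : Form m (m - (1 + k)) :=
  fun x => starAlt m (1 + k) (wedgeAlt (nuForm m x) (α x))

/-- The Hodge star of a form on the sphere (w.r.t. the round metric and the orientation
induced by the outward normal), computed as the restriction of `⋆_{ℝ^m}(ν ∧ ·)`. -/
def starSph (m k : ℕ) (α : FormOn m (sphereSet m) k) :
    FormOn m (sphereSet m) (m - (1 + k)) :=
  fun u => (starAlt m (1 + k) (wedgeAlt (nuForm m u.1) (α u))).compLinearMap (projSph m u.1)

/-- Re-indexing a form along an equality of form degrees. -/
def castForm {m k l : ℕ} (h : k = l) (α : Form m k) : Form m l :=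
  fun x => (α x).domDomCongr (finCongr h)

/-- Re-indexing a form on a subset along an equality of form degrees. -/
def castFormOn {m : ℕ} {M : Set (Vec m)} {k l : ℕ} (h : k = l) (α : FormOn m M k) :
    FormOn m M l :=
  fun x => (α x).domDomCongr (finCongr h)

/-- Trace on the boundary of the simplex vanishes: at every boundary point (a point of some
face `xᵢ = 0`), the form vanishes on vectors tangent to that face. -/
def vanishBdry (m k : ℕ) (a : FormOn m (simplexSet m) k) : Prop :=
  ∀ (x : simplexSet m) (i : Fin m), x.1 i = 0 →
    ∀ v : Fin k → Vec m, (∀ j, (∑ l, v j l) = 0 ∧ v j i = 0) → a x v = 0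

/-- `P̊_rΛ^k(T^{m-1})`: forms in `P_rΛ^k(T^{m-1})` with vanishing trace on the boundary. -/
def PLosim (m k : ℕ) (r : ℤ) : Set (FormOn m (simplexSet m) k) :=
  {a ∈ PLsim m k r | vanishBdry m k a}

/-- `P̊_r⁻Λ^k(T^{m-1})`. -/
def PLmosim (m k : ℕ) (r : ℤ) : Set (FormOn m (simplexSet m) k) :=
  {a ∈ PLmsim m k r | vanishBdry m k a}

/-- A form on the sphere vanishes (as an alternating tensor on the tangent space)
at every point of `S^{m-1} ∩ Γ`, where `Γ = ∪ᵢ {uᵢ = 0}`. -/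
def zeroOnGammaSph (m k : ℕ) (α : FormOn m (sphereSet m) k) : Prop :=
  ∀ u : sphereSet m, (∃ i, u.1 i = 0) →
    ∀ v : Fin k → Vec m, (∀ j, ∑ l, u.1 l * v j l = 0) → α u v = 0

/-- An ambient form vanishes (as an alternating tensor) at every point of `Γ`. -/
def zeroOnGammaAmb (m k : ℕ) (α : Form m k) : Prop :=
  ∀ u : Vec m, (∃ i, u i = 0) → α u = 0

/-- The wedge product of forms on a subset. -/
def wedgeOn {m : ℕ} {M : Set (Vec m)} {k l : ℕ} (a : FormOn m M k) (b : FormOn m M l) :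
    FormOn m M (k + l) :=
  fun x => wedgeAlt (a x) (b x)

/-- The base region of the parametrization of the simplex. -/
def baseSimplex (n : ℕ) : Set (Fin n → ℝ) := {y | (∀ j, 0 ≤ y j) ∧ ∑ j, y j ≤ 1}

/-- Parametrization `y ↦ (1 - Σy, y)` of `T^n` over the base region. -/
def simplexParam (n : ℕ) (y : Fin n → ℝ) : Vec (n + 1) := Fin.cons (1 - ∑ j, y j) y

lemma simplexParam_mem {n : ℕ} {y : Fin n → ℝ} (h : y ∈ baseSimplex n) :
    simplexParam n y ∈ simplexSet (n + 1) := by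
  constructor
  · intro i
    refine Fin.cases ?_ ?_ i
    · simpa [simplexParam] using sub_nonneg.mpr h.2
    · intro j; simpa [simplexParam] using h.1 j
  · simp [simplexParam, Fin.sum_cons]

/-- The coordinate tangent vectors `∂x/∂y_j = e_{j+1} - e_0` of the parametrization,
a positively oriented frame for the orientation of `T^n` induced from the outward-normal
orientation of `S^n` via `Φ`. -/
def simplexTangent (n : ℕ) (j : Fin n) : Vec (n + 1) :=
  Fin.cons (-1) (Pi.single j 1)

open Classical in
/-- The integral of an `n`-form over the oriented simplex `T^n`. -/
def integralSimplex (n : ℕ) (ω : FormOn (n + 1) (simplexSet (n + 1)) n) : ℝ :=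
  ∫ y : Fin n → ℝ,
    if h : y ∈ baseSimplex n then ω ⟨simplexParam n y, simplexParam_mem h⟩ (simplexTangent n)
    else 0

/-- Forms on a subset that genuinely are pullbacks to the simplex: they vanish in the
normal directions (canonical representatives). -/
def TangentialSim (m k : ℕ) (a : FormOn m (simplexSet m) k) : Prop :=
  ∀ x, (a x).compLinearMap (projSim m) = a x

/-- Continuity of a form on a subset. -/
def ContFormOn (m : ℕ) (M : Set (Vec m)) (k : ℕ) (a : FormOn m M k) : Prop :=
  ∀ v : Fin k → Vec m, Continuous fun x : M => a x v

/-- The Riemannian volume form of the round sphere `S^{m-1}` (outward-normal orientation),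
i.e. the restriction of `⋆_{ℝ^m} ν`. -/
def volSph (m : ℕ) : FormOn m (sphereSet m) (m - 1) :=
  fun u => (starAlt m 1 (nuForm m u.1)).compLinearMap (projSph m u.1)


/-- The tuple of standard basis vectors with indices `g`. -/
def stdTuple {m : ℕ} {ι : Type*} (g : ι → Fin m) : ι → Vec m := fun i => Pi.single (g i) 1

/-- The splitting of the `m` slots of a top form into the first `j` and the last `l`. -/
def slotEquiv {m j l : ℕ} (h : j + l = m) : Fin m ≃ Fin j ⊕ Fin l :=
  (finCongr h.symm).trans finSumFinEquiv.symm

lemma contrMany_apply {m : ℕ} (k : ℕ) {j : ℕ} (v : Fin k → Vec m)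
    (α : (Vec m) [⋀^Fin (k + j)]→ₗ[ℝ] ℝ) (w : Fin j → Vec m) :
    contrMany k v α w = α (Fin.append v w) := by
  induction k with
  | zero =>
    simp only [contrMany, AlternatingMap.domDomCongr_apply]
    congr 1
    rw [Subsingleton.elim v Fin.elim0, Fin.elim0_append]
    rfl
  | succ k ih =>
    simp only [contrMany, ih, AlternatingMap.curryLeft_apply_apply,
      AlternatingMap.domDomCongr_apply]
    congr 1
    conv_rhs => rw [← Fin.cons_self_tail v, Fin.append_cons]
    rfl

lemma alternating_sum_apply {m j : ℕ} {ι : Type*} (s : Finset ι)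
    (f : ι → (Vec m) [⋀^Fin j]→ₗ[ℝ] ℝ) (v : Fin j → Vec m) :
    (∑ i ∈ s, f i) v = ∑ i ∈ s, f i v := by
  classical
  induction s using Finset.induction_on with
  | empty => simp
  | insert a s ha ih => simp [Finset.sum_insert ha, ih]

/-- The Hodge star with target degree `l` whenever `j + l = m`. -/
def starLin {m j l : ℕ} (h : j + l = m) :
    ((Vec m) [⋀^Fin j]→ₗ[ℝ] ℝ) →ₗ[ℝ] ((Vec m) [⋀^Fin l]→ₗ[ℝ] ℝ) where
  toFun α := (starAlt m j α).domDomCongr (finCongr (by omega))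
  map_add' α β := by
    ext w
    simp [starAlt, show j ≤ m by omega, alternating_sum_apply, add_mul, Finset.sum_add_distrib, mul_add]
  map_smul' c α := by
    ext w
    simp [starAlt, show j ≤ m by omega, alternating_sum_apply, Finset.mul_sum, mul_assoc, mul_left_comm]

lemma starLin_apply {m j l : ℕ} (h : j + l = m) (α : (Vec m) [⋀^Fin j]→ₗ[ℝ] ℝ)
    (w : Fin l → Vec m) :
    starLin h α w = (j.factorial : ℝ)⁻¹ * ∑ g : Fin j → Fin m,
      α (stdTuple g) * volForm m (Sum.elim (stdTuple g) w ∘ slotEquiv h) := by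
  obtain rfl : l = m - j := by omega
  simp only [starLin, starAlt, show j ≤ m by omega, LinearMap.coe_mk, AddHom.coe_mk,
    AlternatingMap.domDomCongr_apply, dite_true, AlternatingMap.smul_apply,
    alternating_sum_apply, AlternatingMap.smul_apply, contrMany_apply, smul_eq_mul]
  congr 1
  refine Finset.sum_congr rfl fun g _ => ?_
  congr 2
  funext i
  simp only [slotEquiv, Function.comp_apply, Equiv.trans_apply]
  obtain ⟨i', rfl⟩ := (finCongr h).surjective i
  obtain ⟨i'', rfl⟩ := finSumFinEquiv.surjective i'
  rcases i'' with a | a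
  · simp [stdTuple]
  · simp

lemma volForm_stdTuple_ne_zero {m : ℕ} (e : Equiv.Perm (Fin m)) :
    volForm m (stdTuple e) ≠ 0 := by
  have : stdTuple e = (Pi.basisFun ℝ (Fin m)) ∘ e := by
    funext i
    simp only [stdTuple, Function.comp_apply, Pi.basisFun_apply]
  rw [this, AlternatingMap.map_perm, volForm, Module.Basis.det_self]
  rcases Int.units_eq_one_or (Equiv.Perm.sign e) with h | h <;> simp [h]

lemma volForm_sum_perm {m j l : ℕ} (h : j + l = m) (v : Fin j → Vec m) (w : Fin l → Vec m)
    (σ : Equiv.Perm (Fin j)) :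
    volForm m (Sum.elim (v ∘ σ) w ∘ slotEquiv h) =
      Equiv.Perm.sign σ • volForm m (Sum.elim v w ∘ slotEquiv h) := by
  have : Sum.elim (v ∘ σ) w ∘ slotEquiv h = (Sum.elim v w ∘ slotEquiv h) ∘
      ((slotEquiv h).symm.permCongr (Equiv.sumCongr σ 1)) := by
    funext i
    simp only [Function.comp_apply, Equiv.permCongr_apply, Equiv.symm_symm,
      Equiv.apply_symm_apply]
    rcases slotEquiv h i with a | a <;> simp
  rw [this, AlternatingMap.map_perm, Equiv.Perm.sign_permCongr]
  congr 1
  exact (Equiv.Perm.sign_sumCongr σ 1).trans (by simp)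

lemma alternating_ext_std {m j : ℕ} {α β : (Vec m) [⋀^Fin j]→ₗ[ℝ] ℝ}
    (h : ∀ g : Fin j → Fin m, Function.Injective g → α (stdTuple g) = β (stdTuple g)) :
    α = β :=
  (Pi.basisFun ℝ (Fin m)).ext_alternating fun g hg => by
    simp only [Pi.basisFun_apply]
    exact h g hg

lemma exists_sum_extension {m j l : ℕ} (h : j + l = m) {g : Fin j → Fin m}
    (hg : Function.Injective g) : ∃ c : Fin l → Fin m, Function.Bijective (Sum.elim g c) := by
  have hcard : Fintype.card (Fin l) = Fintype.card ↥(Set.range g)ᶜ := by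
    rw [Fintype.card_compl_set, Set.card_range_of_injective hg]
    simp; omega
  let e := Fintype.equivOfCardEq hcard
  refine ⟨fun i => (e i : Fin m), ?_⟩
  rw [Fintype.bijective_iff_injective_and_card]
  refine ⟨hg.sumElim (Subtype.val_injective.comp e.injective) fun a b hab => ?_, by simp [h]⟩
  exact (e b).2 ⟨a, hab⟩

lemma starLin_injective {m j l : ℕ} (h : j + l = m) : Function.Injective (starLin h) := by
  rw [injective_iff_map_eq_zero]
  intro α hα
  refine alternating_ext_std fun f hf => ?_
  obtain ⟨c, hc⟩ := exists_sum_extension h hf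
  have key := starLin_apply h α (stdTuple c)
  rw [hα] at key
  have hterm : ∀ g : Fin j → Fin m,
      volForm m (Sum.elim (stdTuple g) (stdTuple c) ∘ slotEquiv h) ≠ 0 →
      α (stdTuple g) * volForm m (Sum.elim (stdTuple g) (stdTuple c) ∘ slotEquiv h) =
      α (stdTuple f) * volForm m (Sum.elim (stdTuple f) (stdTuple c) ∘ slotEquiv h) := by
    intro g hg
    have hinj : Function.Injective (Sum.elim g c) := by
      by_contra hni
      simp only [Function.Injective, not_forall] at hni
      obtain ⟨a, b, hab, hne⟩ := hni
      refine hg ((volForm m).map_eq_zero_of_eq _ (i := (slotEquiv h).symm a)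
        (j := (slotEquiv h).symm b) ?_ (by simpa using hne))
      simp only [Function.comp_apply, Equiv.apply_symm_apply]
      have hst : Sum.elim (stdTuple g) (stdTuple c) = stdTuple (Sum.elim g c) := by
        funext x; rcases x with x | x <;> rfl
      simp [hst, stdTuple, hab]
    have hrange : ∀ i, ∃ i', f i' = g i := by
      intro i
      obtain ⟨x, hx⟩ := hc.2 (g i)
      rcases x with x | x
      · exact ⟨x, hx⟩
      · have := @hinj (Sum.inl i) (Sum.inr x) (by simpa using hx.symm)
        simp at this
    choose τ hτ using hrange
    have hτi : Function.Injective τ := fun a b hab => by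
      have : g a = g b := by rw [← hτ, ← hτ, hab]
      simpa using @hinj (Sum.inl a) (Sum.inl b) (by simpa using this)
    let σ : Equiv.Perm (Fin j) := Equiv.ofBijective τ (Finite.injective_iff_bijective.1 hτi)
    have hgσ : stdTuple g = (stdTuple f : Fin j → Vec m) ∘ σ := by
      funext i
      simp [stdTuple, σ, hτ]
    rw [hgσ, AlternatingMap.map_perm, volForm_sum_perm]
    rcases Int.units_eq_one_or (Equiv.Perm.sign σ) with hs | hs <;> simp [hs]
  have hf0 : volForm m (Sum.elim (stdTuple f) (stdTuple c) ∘ slotEquiv h) ≠ 0 := by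
    have := volForm_stdTuple_ne_zero ((slotEquiv h).trans (Equiv.ofBijective _ hc))
    convert this using 2
    funext i
    simp only [Function.comp_apply, stdTuple, Equiv.trans_apply, Equiv.ofBijective_apply]
    rcases slotEquiv h i with a | a <;> rfl
  classical
  have hsum : ∑ g : Fin j → Fin m,
      α (stdTuple g) * volForm m (Sum.elim (stdTuple g) (stdTuple c) ∘ slotEquiv h) =
      ((Finset.univ.filter fun g : Fin j → Fin m =>
        volForm m (Sum.elim (stdTuple g) (stdTuple c) ∘ slotEquiv h) ≠ 0).card : ℝ) *
      (α (stdTuple f) * volForm m (Sum.elim (stdTuple f) (stdTuple c) ∘ slotEquiv h)) := by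
    rw [← nsmul_eq_mul, ← Finset.sum_const, Finset.sum_filter]
    refine Finset.sum_congr rfl fun g _ => ?_
    split_ifs with hg
    · exact hterm g hg
    · rw [not_not.1 hg, mul_zero]
  rw [hsum] at key
  have hcard : ((Finset.univ.filter fun g : Fin j → Fin m =>
        volForm m (Sum.elim (stdTuple g) (stdTuple c) ∘ slotEquiv h) ≠ 0).card : ℝ) ≠ 0 := by
    rw [Nat.cast_ne_zero]
    exact Finset.card_ne_zero_of_mem (Finset.mem_filter.2 ⟨Finset.mem_univ f, hf0⟩)
  simpa [hcard, hf0, Nat.factorial_ne_zero] using key.symm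

/-- Values of an alternating tensor on standard basis tuples. -/
def stdCoeffs (m j : ℕ) : ((Vec m) [⋀^Fin j]→ₗ[ℝ] ℝ) →ₗ[ℝ] ((Fin j → Fin m) → ℝ) where
  toFun α g := α (stdTuple g)
  map_add' _ _ := rfl
  map_smul' _ _ := rfl

lemma stdCoeffs_injective (m j : ℕ) : Function.Injective (stdCoeffs m j) :=
  fun _ _ h => alternating_ext_std fun g _ => congrFun h g

lemma finite_alternating (m j : ℕ) : Module.Finite ℝ ((Vec m) [⋀^Fin j]→ₗ[ℝ] ℝ) :=
  Module.Finite.of_injective _ (stdCoeffs_injective m j)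

lemma starLin_bijective {m j l : ℕ} (h : j + l = m) : Function.Bijective (starLin h) := by
  have := finite_alternating m j
  have := finite_alternating m l
  have h1 := LinearMap.finrank_le_finrank_of_injective (starLin_injective h)
  have h2 := LinearMap.finrank_le_finrank_of_injective
    (starLin_injective (show l + j = m by omega))
  exact ⟨starLin_injective h, (LinearMap.injective_iff_surjective_of_finrank_eq_finrank
    (h1.antisymm h2)).1 (starLin_injective h)⟩

lemma degLE_sum_smul {m : ℕ} {r : ℤ} {ι : Type*} (s : Finset ι) (a : ι → ℝ)
    (p : ι → MvPolynomial (Fin m) ℝ) (hp : ∀ i, degLE r (p i)) :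
    degLE r (∑ i ∈ s, a i • p i) := by
  classical
  intro d hd
  obtain ⟨i, -, hi⟩ := Finset.mem_biUnion.1 (MvPolynomial.support_sum hd)
  exact hp i d (MvPolynomial.support_smul hi)

lemma linear_comp_mem_PL {m j l : ℕ} {r : ℤ}
    (T : ((Vec m) [⋀^Fin j]→ₗ[ℝ] ℝ) →ₗ[ℝ] ((Vec m) [⋀^Fin l]→ₗ[ℝ] ℝ))
    {α : Form m j} (hα : α ∈ PL m j r) : (fun x => T (α x)) ∈ PL m l r := by
  classical
  intro v
  obtain ⟨L, hL⟩ := (stdCoeffs m j).exists_leftInverse_of_injective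
    (LinearMap.ker_eq_bot.2 (stdCoeffs_injective m j))
  choose p hp hpe using fun g : Fin j → Fin m => hα (stdTuple g)
  refine ⟨∑ g, T (L (Pi.single g 1)) v • p g, degLE_sum_smul _ _ _ hp, fun x => ?_⟩
  have hx : α x = ∑ g, α x (stdTuple g) • L (Pi.single g 1) := by
    conv_lhs => rw [← LinearMap.id_apply (R := ℝ) (α x), ← hL, LinearMap.comp_apply,
      pi_eq_sum_univ' (stdCoeffs m j (α x)), map_sum]
    refine Finset.sum_congr rfl fun g _ => ?_
    rw [← map_smul]
    rfl
  beta_reduce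
  rw [hx]
  simp [alternating_sum_apply, hpe, MvPolynomial.smul_eval, mul_comm]

lemma wedge_nuForm_apply {m j : ℕ} (x : Vec m) (α : (Vec m) [⋀^Fin j]→ₗ[ℝ] ℝ)
    (v : Fin (1 + j) → Vec m) :
    (j.factorial : ℝ) * wedgeAlt (nuForm m x) α v =
      ∑ σ : Equiv.Perm (Fin 1 ⊕ Fin j), Equiv.Perm.sign σ •
        (dotLin m x (v (finSumFinEquiv (σ (Sum.inl 0)))) *
          α fun i => v (finSumFinEquiv (σ (Sum.inr i)))) := by
  have key := congrArg (fun f => TensorProduct.lid ℝ ℝ (f (v ∘ finSumFinEquiv)))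
    (MultilinearMap.domCoprod_alternization_eq (nuForm m x) α)
  simp only [MultilinearMap.alternatization_apply, map_sum, AlternatingMap.smul_apply,
    Fintype.card_fin, Nat.factorial_one, one_mul, map_nsmul] at key
  rw [wedgeAlt, AlternatingMap.domDomCongr_apply, ← nsmul_eq_mul]
  refine key.symm.trans (Finset.sum_congr rfl fun σ _ => ?_)
  rcases Int.units_eq_one_or (Equiv.Perm.sign σ) with hs | hs <;>
    simp [hs, nuForm, MultilinearMap.domCoprod_apply]

/-- The splitting of the `m` slots of a top form into one slot, then `j`, then `l`. -/
def slotEquiv₃ {m j l : ℕ} (h : (1 + j) + l = m) : Fin m ≃ (Fin 1 ⊕ Fin j) ⊕ Fin l :=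
  (slotEquiv h).trans (Equiv.sumCongr finSumFinEquiv.symm (Equiv.refl _))

lemma volForm_sum_perm₃ {m j l : ℕ} (h : (1 + j) + l = m) (v : Fin 1 ⊕ Fin j → Vec m)
    (w : Fin l → Vec m) (σ : Equiv.Perm (Fin 1 ⊕ Fin j)) :
    volForm m (Sum.elim (v ∘ σ) w ∘ slotEquiv₃ h) =
      Equiv.Perm.sign σ • volForm m (Sum.elim v w ∘ slotEquiv₃ h) := by
  have elim_slot (u : Fin 1 ⊕ Fin j → Vec m) : Sum.elim u w ∘ slotEquiv₃ h =
      Sum.elim (u ∘ finSumFinEquiv.symm) w ∘ slotEquiv h := by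
    funext i
    simp only [slotEquiv₃, Function.comp_apply, Equiv.trans_apply]
    rcases slotEquiv h i with a | a <;> simp
  have := volForm_sum_perm h (v ∘ finSumFinEquiv.symm) w (finSumFinEquiv.permCongr σ)
  rw [Equiv.Perm.sign_permCongr] at this
  rw [elim_slot, elim_slot, ← this]
  congr 3
  funext i
  simp [Equiv.permCongr_apply]

lemma sum_smul_stdTuple {m : ℕ} (x : Vec m) : ∑ i, x i • (Pi.single i 1 : Vec m) = x :=
  (pi_eq_sum_univ' x).symm

lemma volForm_expand {m j l : ℕ} (h : (1 + j) + l = m) (x : Vec m) (u : Fin j → Vec m)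
    (w : Fin l → Vec m) :
    ∑ i, x i * volForm m
        (Sum.elim (Sum.elim (fun _ => Pi.single i 1) u) w ∘ slotEquiv₃ h) =
      volForm m (Sum.elim (Sum.elim (fun _ => x) u) w ∘ slotEquiv₃ h) := by
  have upd (y : Vec m) : Sum.elim (Sum.elim (fun _ => y) u) w ∘ slotEquiv₃ h =
      Function.update (Sum.elim (Sum.elim (fun _ => x) u) w ∘ slotEquiv₃ h)
        ((slotEquiv₃ h).symm (Sum.inl (Sum.inl 0))) y := by
    funext i
    obtain ⟨a, rfl⟩ := (slotEquiv₃ h).symm.surjective i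
    rcases a with (a | a) | a
    · obtain rfl : a = 0 := Subsingleton.elim _ _
      simp
    · simp
    · simp
  conv_rhs => rw [upd x]
  conv_rhs => rw [← sum_smul_stdTuple x]
  rw [AlternatingMap.map_update_sum]
  refine Finset.sum_congr rfl fun i _ => ?_
  rw [AlternatingMap.map_update_smul, upd, sum_smul_stdTuple, smul_eq_mul]

lemma starLin_wedge_nuForm {m j l : ℕ} (h : (1 + j) + l = m) (x : Vec m)
    (α : (Vec m) [⋀^Fin j]→ₗ[ℝ] ℝ) (w : Fin l → Vec m) :
    starLin h (wedgeAlt (nuForm m x) α) w = (j.factorial : ℝ)⁻¹ * ∑ g : Fin j → Fin m,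
      α (stdTuple g) *
        volForm m (Sum.elim (Sum.elim (fun _ => x) (stdTuple g)) w ∘ slotEquiv₃ h) := by
  have hj : (j.factorial : ℝ) ≠ 0 := Nat.cast_ne_zero.2 j.factorial_ne_zero
  have hj' : ((1 + j).factorial : ℝ) ≠ 0 := Nat.cast_ne_zero.2 (1 + j).factorial_ne_zero
  set F : (Fin 1 ⊕ Fin j → Fin m) → ℝ := fun G =>
    (dotLin m x (Pi.single (G (Sum.inl 0)) 1) * α (stdTuple (G ∘ Sum.inr))) *
      volForm m (Sum.elim (stdTuple G) w ∘ slotEquiv₃ h) with hF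
  have hsum : (j.factorial : ℝ) * ∑ g : Fin (1 + j) → Fin m,
      wedgeAlt (nuForm m x) α (stdTuple g) *
        volForm m (Sum.elim (stdTuple g) w ∘ slotEquiv h) =
      ((1 + j).factorial : ℝ) * ∑ G, F G := by
    calc _ = ∑ g : Fin (1 + j) → Fin m, ∑ σ : Equiv.Perm (Fin 1 ⊕ Fin j),
          F ((g ∘ finSumFinEquiv) ∘ σ) := by
          rw [Finset.mul_sum]
          refine Finset.sum_congr rfl fun g _ => ?_
          rw [← mul_assoc, wedge_nuForm_apply, Finset.sum_mul]
          refine Finset.sum_congr rfl fun σ _ => ?_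
          have hv := volForm_sum_perm₃ h (stdTuple (g ∘ finSumFinEquiv)) w σ
          have he : Sum.elim (stdTuple g) w ∘ slotEquiv h =
              Sum.elim (stdTuple (g ∘ finSumFinEquiv)) w ∘ slotEquiv₃ h := by
            funext i
            simp only [slotEquiv₃, Function.comp_apply, Equiv.trans_apply]
            rcases slotEquiv h i with a | a <;> simp [stdTuple]
          have hF' : F ((g ∘ finSumFinEquiv) ∘ σ) =
              (dotLin m x (stdTuple g (finSumFinEquiv (σ (Sum.inl 0)))) *
                α fun i => stdTuple g (finSumFinEquiv (σ (Sum.inr i)))) *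
              volForm m (Sum.elim (stdTuple (g ∘ finSumFinEquiv) ∘ σ) w ∘ slotEquiv₃ h) :=
            rfl
          rw [hF', hv, he, smul_mul_assoc, mul_smul_comm]
      _ = ∑ σ : Equiv.Perm (Fin 1 ⊕ Fin j), ∑ G, F G := by
          rw [Finset.sum_comm]
          refine Finset.sum_congr rfl fun σ _ => ?_
          exact Fintype.sum_equiv
            ((σ.trans finSumFinEquiv).symm.arrowCongr (Equiv.refl (Fin m))) _ _ fun g => rfl
      _ = _ := by
          simp [Finset.sum_const, Fintype.card_perm]
  have hF2 : ∑ G, F G = ∑ g : Fin j → Fin m, α (stdTuple g) *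
        volForm m (Sum.elim (Sum.elim (fun _ => x) (stdTuple g)) w ∘ slotEquiv₃ h) := by
    rw [← (Equiv.sumArrowEquivProdArrow (Fin 1) (Fin j) (Fin m)).symm.sum_comp,
      Fintype.sum_prod_type, Finset.sum_comm]
    refine Finset.sum_congr rfl fun g _ => ?_
    rw [← volForm_expand, Finset.mul_sum, ← (Equiv.funUnique (Fin 1) (Fin m)).symm.sum_comp]
    refine Finset.sum_congr rfl fun i _ => ?_
    have hst : stdTuple (Sum.elim (fun _ : Fin 1 => i) g) =
        Sum.elim (fun _ => Pi.single i 1) (stdTuple g) := by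
      funext a
      rcases a with a | a <;> rfl
    have hd : dotLin m x (Pi.single i 1) = x i := by
      simp [dotLin, Pi.single_apply]
    have hG : (Equiv.sumArrowEquivProdArrow (Fin 1) (Fin j) (Fin m)).symm
        ((Equiv.funUnique (Fin 1) (Fin m)).symm i, g) = Sum.elim (fun _ => i) g := rfl
    have hc : (Sum.elim (fun _ : Fin 1 => i) g) ∘ Sum.inr = g := rfl
    simp only [hF, hG, hst, hc, Sum.elim_inl, hd]
    ring
  rw [starLin_apply, ← hF2]
  field_simp
  linarith [hsum]

/-- Moves the first of the last `l + 1` slots in front of the first `j` slots. -/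
def moveSlot (j l : ℕ) : Fin j ⊕ Fin (l + 1) ≃ (Fin 1 ⊕ Fin j) ⊕ Fin l :=
  ((Equiv.sumCongr (Equiv.refl _) ((finCongr (add_comm l 1)).trans finSumFinEquiv.symm)).trans
    (Equiv.sumAssoc _ _ _).symm).trans (Equiv.sumCongr (Equiv.sumComm _ _) (Equiv.refl _))

lemma elim_moveSlot {m j l : ℕ} (x : Vec m) (u : Fin j → Vec m) (w : Fin l → Vec m)
    (i : Fin j ⊕ Fin (l + 1)) :
    Sum.elim (Sum.elim (fun _ => x) u) w (moveSlot j l i) =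
      Sum.elim u (Fin.cons x w : Fin (l + 1) → Vec m) i := by
  obtain ⟨a, rfl⟩ := (moveSlot j l).symm.surjective i
  rw [Equiv.apply_symm_apply]
  rcases a with (a | a) | a
  · obtain rfl : a = 0 := Subsingleton.elim _ _
    rfl
  · rfl
  · have : (moveSlot j l).symm (Sum.inr a) = Sum.inr a.succ := by
      simp [moveSlot]
    simp [this]

lemma starLin_wedge_nuForm_eq {m j l : ℕ} (h : (1 + j) + l = m) (h' : j + (l + 1) = m) :
    ∃ ε : ℤˣ, ∀ (x : Vec m) (α : (Vec m) [⋀^Fin j]→ₗ[ℝ] ℝ),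
      starLin h (wedgeAlt (nuForm m x) α) = ε • (starLin h' α).curryLeft x := by
  refine ⟨Equiv.Perm.sign ((slotEquiv h').trans ((moveSlot j l).trans (slotEquiv₃ h).symm)),
    fun x α => ?_⟩
  set π := (slotEquiv h').trans ((moveSlot j l).trans (slotEquiv₃ h).symm) with hπ
  ext w
  have hterm (g : Fin j → Fin m) :
      volForm m (Sum.elim (Sum.elim (fun _ => x) (stdTuple g)) w ∘ slotEquiv₃ h) =
        Equiv.Perm.sign π • volForm m
          (Sum.elim (stdTuple g) (Fin.cons x w : Fin (l + 1) → Vec m) ∘ slotEquiv h') := by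
    have : Sum.elim (stdTuple g) (Fin.cons x w : Fin (l + 1) → Vec m) ∘ slotEquiv h' =
        (Sum.elim (Sum.elim (fun _ => x) (stdTuple g)) w ∘ slotEquiv₃ h) ∘ π := by
      funext i
      simp [hπ, elim_moveSlot]
    rw [this, AlternatingMap.map_perm, smul_smul, Int.units_mul_self, one_smul]
  have hc : (starLin h' α).curryLeft x w = starLin h' α (Fin.cons x w) := rfl
  rw [AlternatingMap.smul_apply, hc, starLin_wedge_nuForm, starLin_apply]
  simp only [hterm]
  rcases Int.units_eq_one_or (Equiv.Perm.sign π) with hs | hs <;> simp [hs]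

theorem stmt12 (n k s : ℕ) (hk : k ≤ n) (hs : 1 ≤ s) :
    PLm (n + 1) k (s : ℤ) =
      (fun γ => castForm (show (n + 1) - (1 + (n - k)) = k by omega)
        (starSphAmb (n + 1) (n - k) γ)) '' PL (n + 1) (n - k) ((s : ℤ) - 1) := by
  have h : (1 + (n - k)) + k = n + 1 := by omega
  have h' : (n - k) + (k + 1) = n + 1 := by omega
  obtain ⟨ε, hε⟩ := starLin_wedge_nuForm_eq h h'
  have hstar (γ : Form (n + 1) (n - k)) :
      castForm (show (n + 1) - (1 + (n - k)) = k by omega) (starSphAmb (n + 1) (n - k) γ) =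
        fun x => ε • (starLin h' (γ x)).curryLeft x := by
    funext x
    rw [← hε]
    rfl
  have hεε (y : ℝ) : ((ε : ℤ) : ℝ) * (((ε : ℤ) : ℝ) * y) = y := by
    rcases Int.units_eq_one_or ε with he | he <;> simp [he]
  let T := LinearEquiv.ofBijective (starLin h') (starLin_bijective h')
  apply Set.Subset.antisymm
  · rintro _ ⟨β, hβ, rfl⟩
    refine ⟨_, linear_comp_mem_PL (((ε : ℤ) : ℝ) • T.symm.toLinearMap) hβ, ?_⟩
    beta_reduce
    rw [hstar]
    funext x
    have hT : starLin h' ((((ε : ℤ) : ℝ) • T.symm.toLinearMap) (β x)) =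
        ((ε : ℤ) : ℝ) • β x := by
      rw [LinearMap.smul_apply, map_smul]
      exact congrArg _ (T.apply_symm_apply (β x))
    ext v
    simp only [hT, iU]
    simp [Units.smul_def, hεε]
  · rintro _ ⟨γ, hγ, rfl⟩
    refine ⟨_, linear_comp_mem_PL (((ε : ℤ) : ℝ) • starLin h') hγ, ?_⟩
    beta_reduce
    rw [hstar]
    funext x
    ext v
    simp [iU, Units.smul_def]

end
end

section
/- Let n ≥ 0 and s ≥ 0, and consider i_U : P_sΛ^k(ℝ^{n+1}) → P_{s+1}Λ^{k-1}(ℝ^{n+1}), the interior product with the radial vector field U. If k ≥ 1, then the kernel of i_U equals P_s^-Λ^k(ℝ^{n+1}). If k = 0, then the kernel of i_U equals all of P_sΛ^0(ℝ^{n+1}), which equals P_s^-Λ^0(ℝ^{n+1}) + P_0Λ^0(ℝ^{n+1}). -/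
open scoped BigOperators
open MeasureTheory

noncomputable section

lemma degLE_iff_coeff {m : ℕ} {r : ℤ} {p : MvPolynomial (Fin m) ℝ} :
    degLE r p ↔ ∀ d : Fin m →₀ ℕ, r < (d.degree : ℤ) → p.coeff d = 0 := by
  simp only [degLE, MvPolynomial.mem_support_iff, ← not_le]
  exact forall_congr' fun d => not_imp_comm

lemma degLE.mono {m : ℕ} {r r' : ℤ} {p : MvPolynomial (Fin m) ℝ} (hp : degLE r p)
    (h : r ≤ r') : degLE r' p :=
  fun d hd => (hp d hd).trans h

lemma degLE_zero {m : ℕ} (r : ℤ) : degLE r (0 : MvPolynomial (Fin m) ℝ) := by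
  simp [degLE]

lemma degLE_C {m : ℕ} {r : ℤ} (hr : 0 ≤ r) (a : ℝ) :
    degLE r (MvPolynomial.C a : MvPolynomial (Fin m) ℝ) := by
  classical
  rw [degLE_iff_coeff]
  intro d hd
  rw [MvPolynomial.coeff_C, if_neg]
  rintro rfl
  simp at hd
  omega

lemma degLE.add {m : ℕ} {r : ℤ} {p q : MvPolynomial (Fin m) ℝ} (hp : degLE r p)
    (hq : degLE r q) : degLE r (p + q) := by
  rw [degLE_iff_coeff] at *
  intro d hd
  rw [MvPolynomial.coeff_add, hp d hd, hq d hd, add_zero]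

lemma degLE_sum {m : ℕ} {r : ℤ} {ι : Type*} (t : Finset ι) {p : ι → MvPolynomial (Fin m) ℝ}
    (hp : ∀ i ∈ t, degLE r (p i)) : degLE r (∑ i ∈ t, p i) :=
  Finset.sum_induction p (degLE r) (fun _ _ => degLE.add) (degLE_zero r) hp

lemma degLE.smul {m : ℕ} {r : ℤ} {p : MvPolynomial (Fin m) ℝ} (hp : degLE r p) (a : ℝ) :
    degLE r (a • p) := by
  rw [degLE_iff_coeff] at *
  intro d hd
  rw [MvPolynomial.coeff_smul, hp d hd, smul_zero]

lemma degLE.zsmul {m : ℕ} {r : ℤ} {p : MvPolynomial (Fin m) ℝ} (hp : degLE r p) (a : ℤ) :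
    degLE r (a • p) := by
  rw [← Int.cast_smul_eq_zsmul ℝ]
  exact hp.smul _

lemma degLE.X_mul {m : ℕ} {r : ℤ} {p : MvPolynomial (Fin m) ℝ} (hp : degLE (r - 1) p)
    (j : Fin m) : degLE r (MvPolynomial.X j * p) := by
  classical
  rw [degLE_iff_coeff] at *
  intro d hd
  rw [MvPolynomial.coeff_X_mul']
  split_ifs with hj
  · refine hp _ ?_
    have h : Finsupp.single j 1 ≤ d := by
      rw [Finsupp.single_le_iff]
      exact Nat.one_le_iff_ne_zero.mpr (Finsupp.mem_support_iff.mp hj)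
    have h2 : (d - Finsupp.single j 1).degree + 1 = d.degree := by
      conv_rhs => rw [← tsub_add_cancel_of_le h]
      simp [map_add]
    omega
  · rfl

lemma degLE.pderiv {m : ℕ} {r : ℤ} {p : MvPolynomial (Fin m) ℝ} (hp : degLE r p)
    (j : Fin m) : degLE (r - 1) (MvPolynomial.pderiv j p) := by
  rw [degLE_iff_coeff] at *
  intro d hd
  rw [MvPolynomial.coeff_pderiv, hp, zero_mul]
  simp only [map_add, Finsupp.degree_single, Nat.cast_add, Nat.cast_one]
  omega

/-- The directional derivative of polynomials, linear in the direction. -/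
def dirDeriv (m : ℕ) :
    Vec m →ₗ[ℝ] MvPolynomial (Fin m) ℝ →ₗ[ℝ] MvPolynomial (Fin m) ℝ :=
  ∑ j, (LinearMap.proj j : Vec m →ₗ[ℝ] ℝ).smulRight (MvPolynomial.pderiv j).toLinearMap

lemma dirDeriv_apply {m : ℕ} (w : Vec m) (p : MvPolynomial (Fin m) ℝ) :
    dirDeriv m w p = ∑ j, w j • MvPolynomial.pderiv j p := by
  simp [dirDeriv]

lemma degLE.dirDeriv {m : ℕ} {r : ℤ} {p : MvPolynomial (Fin m) ℝ} (hp : degLE r p)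
    (w : Vec m) : degLE (r - 1) (dirDeriv m w p) := by
  rw [dirDeriv_apply]
  exact degLE_sum _ fun j _ => (hp.pderiv j).smul _

lemma dirDeriv_X_mul {m : ℕ} (w : Vec m) (j : Fin m) (p : MvPolynomial (Fin m) ℝ) :
    dirDeriv m w (MvPolynomial.X j * p) = MvPolynomial.X j * dirDeriv m w p + w j • p := by
  classical
  simp [dirDeriv_apply, MvPolynomial.pderiv_X, Pi.single_apply, Finset.sum_add_distrib,
    Finset.mul_sum]

/-- Division of the homogeneous component of degree `d` by `d + c`. -/
def degDiv (m c : ℕ) : MvPolynomial (Fin m) ℝ →ₗ[ℝ] MvPolynomial (Fin m) ℝ :=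
  (MvPolynomial.basisMonomials (Fin m) ℝ).constr ℝ
    fun d => MvPolynomial.monomial d (((d.degree + c : ℕ) : ℝ)⁻¹)

lemma degDiv_monomial {m c : ℕ} (d : Fin m →₀ ℕ) (a : ℝ) :
    degDiv m c (MvPolynomial.monomial d a) =
      MvPolynomial.monomial d (((d.degree + c : ℕ) : ℝ)⁻¹ * a) := by
  have h : MvPolynomial.monomial d a
      = a • MvPolynomial.basisMonomials (Fin m) ℝ d := by
    simp [MvPolynomial.smul_monomial]
  rw [h, map_smul, degDiv, Module.Basis.constr_basis, MvPolynomial.smul_monomial, smul_eq_mul,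
    mul_comm]

lemma coeff_degDiv {m c : ℕ} (p : MvPolynomial (Fin m) ℝ) (d : Fin m →₀ ℕ) :
    (degDiv m c p).coeff d = ((d.degree + c : ℕ) : ℝ)⁻¹ * p.coeff d := by
  classical
  induction p using MvPolynomial.induction_on' with
  | monomial u a =>
    rw [degDiv_monomial, MvPolynomial.coeff_monomial, MvPolynomial.coeff_monomial]
    split_ifs with h
    · rw [h]
    · rw [mul_zero]
  | add p q hp hq => rw [map_add, MvPolynomial.coeff_add, hp, hq, MvPolynomial.coeff_add, mul_add]

lemma degLE.degDiv {m : ℕ} {r : ℤ} {p : MvPolynomial (Fin m) ℝ} (hp : degLE r p)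
    (c : ℕ) : degLE r (degDiv m c p) := by
  rw [degLE_iff_coeff] at *
  intro d hd
  rw [coeff_degDiv, hp d hd, mul_zero]

lemma degDiv_X_mul {m : ℕ} (c : ℕ) (j : Fin m) (p : MvPolynomial (Fin m) ℝ) :
    degDiv m c (MvPolynomial.X j * p) = MvPolynomial.X j * degDiv m (c + 1) p := by
  induction p using MvPolynomial.induction_on' with
  | monomial u a =>
    rw [MvPolynomial.X, MvPolynomial.monomial_mul, degDiv_monomial, degDiv_monomial,
      MvPolynomial.monomial_mul]
    simp only [map_add, Finsupp.degree_single, one_mul]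
    rw [add_comm 1, add_assoc, add_comm 1]
  | add p q hp hq => rw [mul_add, map_add, hp, hq, map_add, mul_add]

/-- The contraction `∑ⱼ Xⱼ L(eⱼ)` of a polynomial-valued linear map with the radial field. -/
def radialContr {m : ℕ} (L : Vec m →ₗ[ℝ] MvPolynomial (Fin m) ℝ) : MvPolynomial (Fin m) ℝ :=
  ∑ j, MvPolynomial.X j * L (Pi.single j 1)

lemma eval_radialContr {m : ℕ} (L : Vec m →ₗ[ℝ] MvPolynomial (Fin m) ℝ) (x : Vec m) :
    MvPolynomial.eval x (radialContr L) = MvPolynomial.eval x (L x) := by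
  have h : L x = ∑ j, x j • L (Pi.single j 1) := by
    conv_lhs => rw [pi_eq_sum_univ' x]
    simp [Pi.single]
  simp [radialContr, h, MvPolynomial.smul_eval]

lemma degDiv_radialContr {m : ℕ} (c : ℕ) (L : Vec m →ₗ[ℝ] MvPolynomial (Fin m) ℝ) :
    degDiv m c (radialContr L) = radialContr (degDiv m (c + 1) ∘ₗ L) := by
  simp [radialContr, degDiv_X_mul]

lemma dirDeriv_radialContr {m : ℕ} (w : Vec m) (L : Vec m →ₗ[ℝ] MvPolynomial (Fin m) ℝ) :
    dirDeriv m w (radialContr L) = radialContr (dirDeriv m w ∘ₗ L) + L w := by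
  have h : L w = ∑ j, w j • L (Pi.single j 1) := by
    conv_lhs => rw [pi_eq_sum_univ' w]
    simp [Pi.single]
  simp [radialContr, dirDeriv_X_mul, Finset.sum_add_distrib, h]

lemma coeff_X_mul_pderiv {m : ℕ} (j : Fin m) (p : MvPolynomial (Fin m) ℝ) (d : Fin m →₀ ℕ) :
    (MvPolynomial.X j * MvPolynomial.pderiv j p).coeff d = (d j : ℝ) * p.coeff d := by
  classical
  induction p using MvPolynomial.induction_on' with
  | monomial u a =>
    rw [MvPolynomial.X_mul_pderiv_monomial, MvPolynomial.coeff_smul, MvPolynomial.coeff_monomial]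
    split_ifs with hu
    · simp [hu]
    · simp
  | add p q hp hq =>
    rw [map_add, mul_add, MvPolynomial.coeff_add, hp, hq, MvPolynomial.coeff_add, mul_add]

/-- Euler's operator acts on the homogeneous component of degree `d` as multiplication by `d`. -/
lemma coeff_radialContr_dirDeriv {m : ℕ} (p : MvPolynomial (Fin m) ℝ) (d : Fin m →₀ ℕ) :
    (radialContr ((dirDeriv m).flip p)).coeff d = (d.degree : ℝ) * p.coeff d := by
  classical
  have h : radialContr ((dirDeriv m).flip p)
      = ∑ j, MvPolynomial.X j * MvPolynomial.pderiv j p := by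
    simp [radialContr, dirDeriv_apply, Pi.single_apply]
  rw [h, MvPolynomial.coeff_sum, Finsupp.degree_eq_sum, Nat.cast_sum, Finset.sum_mul]
  refine Finset.sum_congr rfl fun j _ => ?_
  exact coeff_X_mul_pderiv j p d

lemma degDiv_euler_add {m c : ℕ} (hc : c ≠ 0) (p : MvPolynomial (Fin m) ℝ) :
    degDiv m c (radialContr ((dirDeriv m).flip p) + c • p) = p := by
  ext d
  rw [coeff_degDiv, MvPolynomial.coeff_add, coeff_radialContr_dirDeriv, MvPolynomial.coeff_smul,
    nsmul_eq_mul, ← add_mul, ← Nat.cast_add, inv_mul_cancel_left₀]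
  exact_mod_cast (by omega : d.degree + c ≠ 0)

lemma degDiv_euler {m : ℕ} (p : MvPolynomial (Fin m) ℝ) :
    degDiv m 0 (radialContr ((dirDeriv m).flip p)) + MvPolynomial.C (p.coeff 0) = p := by
  classical
  ext d
  rw [MvPolynomial.coeff_add, coeff_degDiv, coeff_radialContr_dirDeriv, MvPolynomial.coeff_C]
  split_ifs with h
  · subst h
    simp
  · have : (d.degree : ℝ) ≠ 0 := by
      rw [Nat.cast_ne_zero, Ne, Finsupp.degree_eq_zero_iff]
      exact fun h' => h h'.symm
    rw [add_zero, add_zero, inv_mul_cancel_left₀ this]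

/-- A polynomial form is an alternating map with values in polynomials. -/
lemma exists_alternatingMap_of_mem_PL {m k : ℕ} {r : ℤ} {α : Form m k} (hα : α ∈ PL m k r) :
    ∃ A : Vec m [⋀^Fin k]→ₗ[ℝ] MvPolynomial (Fin m) ℝ,
      (∀ v, degLE r (A v)) ∧ ∀ x v, α x v = MvPolynomial.eval x (A v) := by
  choose p hp hpe using hα
  refine ⟨⟨⟨p, ?_, ?_⟩, ?_⟩, hp, fun x v => hpe v x⟩
  · intro _ v i a b
    refine MvPolynomial.funext fun x => ?_
    rw [map_add, ← hpe, ← hpe, ← hpe]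
    convert (α x).map_update_add v i a b
  · intro _ v i c a
    refine MvPolynomial.funext fun x => ?_
    rw [MvPolynomial.smul_eval, ← hpe, ← hpe]
    rw [← smul_eq_mul]
    convert (α x).map_update_smul v i c a
  · intro v i j hv hij
    refine MvPolynomial.funext fun x => ?_
    rw [map_zero]
    exact (hpe v x).symm.trans ((α x).map_eq_zero_of_eq v hv hij)

/-- The form defined by an alternating map with values in polynomials. -/
def evalForm {m k : ℕ} (A : Vec m [⋀^Fin k]→ₗ[ℝ] MvPolynomial (Fin m) ℝ) : Form m k :=
  fun x => (MvPolynomial.aeval x).toLinearMap.compAlternatingMap A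

lemma evalForm_apply {m k : ℕ} (A : Vec m [⋀^Fin k]→ₗ[ℝ] MvPolynomial (Fin m) ℝ) (x : Vec m)
    (v : Fin k → Vec m) : evalForm A x v = MvPolynomial.eval x (A v) := by
  simp [evalForm, MvPolynomial.aeval_eq_eval]

lemma evalForm_mem_PL {m k : ℕ} {r : ℤ} {A : Vec m [⋀^Fin k]→ₗ[ℝ] MvPolynomial (Fin m) ℝ}
    (hA : ∀ v, degLE r (A v)) : evalForm A ∈ PL m k r :=
  fun v => ⟨A v, hA v, fun x => evalForm_apply A x v⟩

lemma PL_add {m k : ℕ} {r : ℤ} {α β : Form m k} (hα : α ∈ PL m k r) (hβ : β ∈ PL m k r) :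
    α + β ∈ PL m k r := by
  intro v
  obtain ⟨p, hp, hpe⟩ := hα v
  obtain ⟨q, hq, hqe⟩ := hβ v
  exact ⟨p + q, hp.add hq, fun x => by simp [hpe, hqe]⟩

lemma PL_mono {m k : ℕ} {r r' : ℤ} (h : r ≤ r') : PL m k r ⊆ PL m k r' := by
  intro α hα v
  obtain ⟨p, hp, hpe⟩ := hα v
  exact ⟨p, hp.mono h, hpe⟩

lemma iU_iU {m k : ℕ} (β : Form m (k + 2)) : iU (iU β) = 0 :=
  funext fun x => (β x).curryLeft_same x

/-- An alternating map as a linear function of its first argument. -/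
def firstSlot {m k : ℕ} (A : Vec m [⋀^Fin (k + 1)]→ₗ[ℝ] MvPolynomial (Fin m) ℝ)
    (u : Fin k → Vec m) : Vec m →ₗ[ℝ] MvPolynomial (Fin m) ℝ where
  toFun w := A (Matrix.vecCons w u)
  map_add' w w' := A.map_vecCons_add u w w'
  map_smul' a w := A.map_vecCons_smul u a w

lemma firstSlot_apply {m k : ℕ} (A : Vec m [⋀^Fin (k + 1)]→ₗ[ℝ] MvPolynomial (Fin m) ℝ)
    (u : Fin k → Vec m) (w : Vec m) : firstSlot A u w = A (Matrix.vecCons w u) := rfl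

lemma PLm_subset_PL (m k : ℕ) (r : ℤ) : PLm m k r ⊆ PL m k r := by
  rintro _ ⟨β, hβ, rfl⟩ v
  obtain ⟨B, hB, hBe⟩ := exists_alternatingMap_of_mem_PL hβ
  refine ⟨radialContr (firstSlot B v),
    degLE_sum _ fun j _ => (hB _).X_mul j, fun x => ?_⟩
  rw [eval_radialContr]
  exact hBe x _

/-- The exterior derivative with the homogeneous component of total degree `d` divided
by `d + c`. -/
def scaledExtDeriv {m k : ℕ} (c : ℕ) (A : Vec m [⋀^Fin k]→ₗ[ℝ] MvPolynomial (Fin m) ℝ) :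
    Vec m [⋀^Fin (k + 1)]→ₗ[ℝ] MvPolynomial (Fin m) ℝ :=
  AlternatingMap.alternatizeUncurryFin
    { toFun := fun w => (degDiv m c ∘ₗ dirDeriv m w).compAlternatingMap A
      map_add' := fun w w' => by ext v; simp
      map_smul' := fun a w => by ext v; simp }

lemma scaledExtDeriv_apply {m k : ℕ} (c : ℕ)
    (A : Vec m [⋀^Fin k]→ₗ[ℝ] MvPolynomial (Fin m) ℝ) (v : Fin (k + 1) → Vec m) :
    scaledExtDeriv c A v =
      ∑ i : Fin (k + 1), (-1) ^ (i : ℕ) • degDiv m c (dirDeriv m (v i) (A (i.removeNth v))) := by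
  rw [scaledExtDeriv, AlternatingMap.alternatizeUncurryFin_apply]
  rfl

lemma degLE_scaledExtDeriv {m k : ℕ} {r : ℤ} (c : ℕ)
    {A : Vec m [⋀^Fin k]→ₗ[ℝ] MvPolynomial (Fin m) ℝ} (hA : ∀ v, degLE r (A v))
    (v : Fin (k + 1) → Vec m) : degLE (r - 1) (scaledExtDeriv c A v) := by
  rw [scaledExtDeriv_apply]
  exact degLE_sum _ fun i _ => (((hA _).dirDeriv _).degDiv c).zsmul _

lemma iU_evalForm_scaledExtDeriv {m k : ℕ} (c : ℕ)
    (A : Vec m [⋀^Fin k]→ₗ[ℝ] MvPolynomial (Fin m) ℝ) (x : Vec m) (v : Fin k → Vec m) :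
    iU (evalForm (scaledExtDeriv (c + 1) A)) x v =
      MvPolynomial.eval x (degDiv m c (radialContr ((dirDeriv m).flip (A v)))) +
      ∑ i : Fin k, (-1) ^ ((i : ℕ) + 1) * MvPolynomial.eval x (degDiv m (c + 1)
        (dirDeriv m (v i) (A (i.succ.removeNth (Matrix.vecCons x v))))) := by
  rw [degDiv_radialContr, eval_radialContr, iU, AlternatingMap.curryLeft_apply_apply,
    evalForm_apply, scaledExtDeriv_apply, Fin.sum_univ_succ, map_add, map_sum]
  congr 1
  · simp [Matrix.vecCons, Fin.removeNth_zero]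
  · refine Finset.sum_congr rfl fun i _ => ?_
    rw [map_zsmul]
    simp

/-- On the kernel of the contraction with the radial field, the scaled exterior derivative is a
right inverse of that contraction. -/
lemma iU_evalForm_scaledExtDeriv_of_iU_eq_zero {m k : ℕ}
    (A : Vec m [⋀^Fin (k + 1)]→ₗ[ℝ] MvPolynomial (Fin m) ℝ) (hA : iU (evalForm A) = 0) :
    iU (evalForm (scaledExtDeriv (k + 1 + 1) A)) = evalForm A := by
  have hker : ∀ u : Fin k → Vec m,
      radialContr (firstSlot A u) = 0 := by
    intro u
    refine MvPolynomial.funext fun x => ?_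
    rw [eval_radialContr, map_zero]
    have h := congrArg (fun B => B u) (congrFun hA x)
    exact (evalForm_apply A x _).symm.trans h
  funext x
  ext v
  have hterm : ∀ i : Fin (k + 1), (-1) ^ ((i : ℕ) + 1) * MvPolynomial.eval x
      (degDiv m (k + 1 + 1) (dirDeriv m (v i) (A (i.succ.removeNth (Matrix.vecCons x v))))) =
      MvPolynomial.eval x (degDiv m (k + 1) (A v)) := by
    intro i
    set L := firstSlot A (i.removeNth v) with hL
    have h1 : radialContr (dirDeriv m (v i) ∘ₗ L) = -L (v i) := by
      rw [eq_neg_iff_add_eq_zero, ← dirDeriv_radialContr, hL, hker, map_zero]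
    have h2 : A (i.succ.removeNth (Matrix.vecCons x v)) = L x := by
      rw [hL, firstSlot_apply]
      congr 1
      funext j
      refine Fin.cases ?_ (fun j' => ?_) j <;> simp [Fin.removeNth]
    have h3 : L (v i) = (-1) ^ (i : ℕ) • A v := by
      rw [hL, firstSlot_apply, ← A.neg_one_pow_smul_map_insertNth i, Fin.insertNth_self_removeNth]
    have h4 := eval_radialContr (degDiv m (k + 1 + 1) ∘ₗ dirDeriv m (v i) ∘ₗ L) x
    rw [← degDiv_radialContr, h1, h3] at h4
    rw [h2, ← LinearMap.comp_apply, ← LinearMap.comp_apply, LinearMap.comp_assoc, ← h4,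
      map_neg, map_zsmul, map_neg, map_zsmul]
    rw [pow_succ, zsmul_eq_mul]
    push_cast
    rw [mul_neg_one, neg_mul_neg, ← mul_assoc, ← mul_pow]
    norm_num
  rw [iU_evalForm_scaledExtDeriv, Finset.sum_congr rfl fun i _ => hterm i, Finset.sum_const,
    Finset.card_univ, Fintype.card_fin, ← map_nsmul, ← map_nsmul, ← map_add, ← map_add,
    degDiv_euler_add (Nat.succ_ne_zero k), evalForm_apply]

theorem stmt14 (n s : ℕ) :
    (∀ k : ℕ, {α ∈ PL (n + 1) (k + 1) (s : ℤ) | iU α = 0} = PLm (n + 1) (k + 1) (s : ℤ)) ∧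
    PL (n + 1) 0 (s : ℤ) =
      {α | ∃ β ∈ PLm (n + 1) 0 (s : ℤ), ∃ γ ∈ PL (n + 1) 0 (0 : ℤ), α = β + γ} := by
  have hrepr : ∀ {k : ℕ} {α : Form (n + 1) k}, α ∈ PL (n + 1) k (s : ℤ) →
      ∃ A : Vec (n + 1) [⋀^Fin k]→ₗ[ℝ] MvPolynomial (Fin (n + 1)) ℝ,
        (∀ v, degLE s (A v)) ∧ evalForm A = α := by
    intro k α hα
    obtain ⟨A, hA, hAe⟩ := exists_alternatingMap_of_mem_PL hα
    refine ⟨A, hA, funext fun x => ?_⟩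
    ext v
    rw [evalForm_apply, hAe]
  refine ⟨fun k => Set.Subset.antisymm ?_ ?_, Set.Subset.antisymm ?_ ?_⟩
  · rintro α ⟨hα, hker⟩
    obtain ⟨A, hA, rfl⟩ := hrepr hα
    exact ⟨_, evalForm_mem_PL (degLE_scaledExtDeriv _ hA),
      iU_evalForm_scaledExtDeriv_of_iU_eq_zero A hker⟩
  · intro α hα
    refine ⟨PLm_subset_PL _ _ _ hα, ?_⟩
    obtain ⟨β, -, rfl⟩ := hα
    exact iU_iU β
  · intro α hα
    obtain ⟨A, hA, rfl⟩ := hrepr hα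
    refine ⟨_, ⟨_, evalForm_mem_PL (degLE_scaledExtDeriv 1 hA), rfl⟩,
      fun _ => AlternatingMap.constOfIsEmpty ℝ (Vec (n + 1)) (Fin 0) ((A ![]).coeff 0),
      fun v => ⟨MvPolynomial.C ((A ![]).coeff 0), degLE_C le_rfl _, fun x => by simp⟩, ?_⟩
    funext x
    ext v
    rw [Subsingleton.elim v ![], Pi.add_apply, AlternatingMap.add_apply, evalForm_apply,
      iU_evalForm_scaledExtDeriv 0, Finset.univ_eq_empty, Finset.sum_empty, add_zero]
    conv_lhs => rw [← degDiv_euler (A ![])]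
    simp
  · rintro _ ⟨β, hβ, γ, hγ, rfl⟩
    exact PL_add (PLm_subset_PL _ _ _ hβ) (PL_mono (Int.natCast_nonneg s) hγ)

end
end
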